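/- For every i ∈ {1,...,5}: every vertex z ∈ S2 has at most one neighbor in B_i, and every vertex y ∈ B_i has at most one neighbor in S2; consequently |B_1| + |B_2| + |B_3| + |B_4| + |B_5| ≥ |S2|. -/

import Mathlib

open SimpleGraph

/-- The disjoint union `P2 ∪ P3`: an edge 0-1 together with a path 2-3-4. -/
def p2p3 : SimpleGraph (Fin 5) :=
  SimpleGraph.fromEdgeSet {s(0,1), s(2,3), s(3,4)}

variable {V : Type*}

/-- `S0` is the vertex set of the induced 5-cycle. -/
def S0 (v : Fin 5 → V) : Set V := Set.range v

/-- `Aset H v i` is the set of vertices outside `S0` whose neighborhood in `S0`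
is exactly `{v i}`. -/
def Aset (H : SimpleGraph V) (v : Fin 5 → V) (i : Fin 5) : Set V :=
  {x | x ∉ S0 v ∧ ∀ j : Fin 5, H.Adj x (v j) ↔ j = i}

/-- `Bset H v i` is the set of vertices outside `S0` whose neighborhood in `S0`
is exactly `{v (i-1), v (i+1)}`. -/
def Bset (H : SimpleGraph V) (v : Fin 5 → V) (i : Fin 5) : Set V :=
  {x | x ∉ S0 v ∧ ∀ j : Fin 5, H.Adj x (v j) ↔ (j = i - 1 ∨ j = i + 1)}

/-- `S2set H v` is the set of vertices at distance exactly 2 from `S0`: vertices outside `S0`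
with no neighbor in `S0` but with a neighbor having a neighbor in `S0`. -/
def S2set (H : SimpleGraph V) (v : Fin 5 → V) : Set V :=
  {x | x ∉ S0 v ∧ (∀ j : Fin 5, ¬ H.Adj x (v j)) ∧
    ∃ y, H.Adj x y ∧ ∃ j : Fin 5, H.Adj y (v j)}

/-- `S` is complete to `T`: every vertex of `S` is adjacent to every vertex of `T`. -/
def Complete (H : SimpleGraph V) (S T : Set V) : Prop := ∀ x ∈ S, ∀ y ∈ T, H.Adj x y

/-- `S` is anticomplete to `T`: there are no edges between `S` and `T`. -/
def Anticomplete (H : SimpleGraph V) (S T : Set V) : Prop := ∀ x ∈ S, ∀ y ∈ T, ¬ H.Adj x y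

/-- `hA` is the number of indices `i` with `A_i` nonempty. -/
noncomputable def hA (H : SimpleGraph V) (v : Fin 5 → V) : ℕ :=
  {i : Fin 5 | (Aset H v i).Nonempty}.ncard

/-- `hB` is the number of indices `i` with `B_i` nonempty. -/
noncomputable def hB (H : SimpleGraph V) (v : Fin 5 → V) : ℕ :=
  {i : Fin 5 | (Bset H v i).Nonempty}.ncard

/-- An edge `a b` and an induced path `c d e` with no edges between them form an induced
`P2 ∪ P3`. -/
lemma nonempty_p2p3_embedding {V : Type*} {H : SimpleGraph V} {a b c d e : V}
    (hab : H.Adj a b) (hcd : H.Adj c d) (hde : H.Adj d e) (hne : c ≠ e) (hce : ¬ H.Adj c e)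
    (hac : ¬ H.Adj a c) (had : ¬ H.Adj a d) (hae : ¬ H.Adj a e)
    (hbc : ¬ H.Adj b c) (hbd : ¬ H.Adj b d) (hbe : ¬ H.Adj b e) :
    Nonempty (p2p3 ↪g H) := by
  have hadj : ∀ i j : Fin 5, H.Adj (![a, b, c, d, e] i) (![a, b, c, d, e] j) ↔ p2p3.Adj i j := by
    intro i j
    fin_cases i <;> fin_cases j <;> simp [p2p3, H.adj_comm, *]
  have hinj : Function.Injective ![a, b, c, d, e] := by
    have hac' : a ≠ c := fun h => had (h ▸ hcd)
    have had' : a ≠ d := fun h => hae (h ▸ hde)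
    have hae' : a ≠ e := fun h => had (h ▸ hde.symm)
    have hbc' : b ≠ c := fun h => hbd (h ▸ hcd)
    have hbd' : b ≠ d := fun h => hbe (h ▸ hde)
    have hbe' : b ≠ e := fun h => hbd (h ▸ hde.symm)
    have hab' := hab.ne
    have hcd' := hcd.ne
    have hde' := hde.ne
    intro i j hij
    fin_cases i <;> fin_cases j <;> simp_all
  exact ⟨⟨⟨_, hinj⟩, hadj _ _⟩⟩

lemma not_adj_of_common_neighbor {V : Type*} {H : SimpleGraph V} (h : H.CliqueFree 3)
    {a b c : V} (hab : H.Adj a b) (hac : H.Adj a c) : ¬ H.Adj b c := by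
  classical
  exact fun hbc => h {a, b, c} (is3Clique_triple_iff.mpr ⟨hab, hac, hbc⟩)

/-- Two neighbors `c`, `e` of `d` coincide when an edge `a b` is anticomplete to `{c, d, e}`. -/
lemma eq_of_adj_of_missing_edge {V : Type*} {H : SimpleGraph V} (htri : H.CliqueFree 3)
    (hfree : ¬ Nonempty (p2p3 ↪g H)) {a b c d e : V} (hab : H.Adj a b)
    (hdc : H.Adj d c) (hde : H.Adj d e)
    (hca : ¬ H.Adj c a) (hcb : ¬ H.Adj c b) (hda : ¬ H.Adj d a) (hdb : ¬ H.Adj d b)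
    (hea : ¬ H.Adj e a) (heb : ¬ H.Adj e b) : c = e := by
  by_contra hne
  rw [H.adj_comm] at hca hcb hda hdb hea heb
  exact hfree (nonempty_p2p3_embedding hab hdc.symm hde hne
    (not_adj_of_common_neighbor htri hdc hde) hca hda hea hcb hdb heb)

lemma not_adj_opposite_of_mem_Bset {V : Type*} {H : SimpleGraph V} {v : Fin 5 → V} {i : Fin 5}
    {y : V} (hy : y ∈ Bset H v i) : ¬ H.Adj y (v (i + 2)) ∧ ¬ H.Adj y (v (i + 3)) := by
  rw [hy.2, hy.2]
  clear hy
  decide +revert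

/-- Every vertex of `S2` has a neighbor in some `B_i`. -/
lemma exists_adj_mem_Bset {V : Type*} {H : SimpleGraph V} {v : Fin 5 → V}
    (hinj : Function.Injective v)
    (hC5 : ∀ i j : Fin 5, H.Adj (v i) (v j) ↔ (j = i + 1 ∨ i = j + 1))
    (htri : H.CliqueFree 3) (hfree : ¬ Nonempty (p2p3 ↪g H)) {z : V} (hz : z ∈ S2set H v) :
    ∃ y i, H.Adj z y ∧ y ∈ Bset H v i := by
  obtain ⟨-, hz0, y, hzy, j, hyj⟩ := hz
  have hy0 : y ∉ S0 v := by
    rintro ⟨k, rfl⟩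
    exact hz0 k hzy
  have hstep : ∀ k, H.Adj y (v k) → ¬ H.Adj y (v (k + 1)) := fun k hk hk' =>
    not_adj_of_common_neighbor htri hk hk' ((hC5 _ _).mpr (Or.inl rfl))
  have hsecond : H.Adj y (v (j + 2)) ∨ H.Adj y (v (j + 3)) := by
    by_contra! hno
    have h4 : ¬ H.Adj y (v (j + 4)) := fun h => hstep _ h (by
      rwa [show j + 4 + 1 = j by clear * -; decide +revert])
    refine hfree (nonempty_p2p3_embedding hzy (c := v (j + 2)) (d := v (j + 3)) (e := v (j + 4))
      ?_ ?_ ?_ ?_ (hz0 _) (hz0 _) (hz0 _) hno.1 hno.2 h4)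
    · rw [hC5]; clear * -; decide +revert
    · rw [hC5]; clear * -; decide +revert
    · rw [hinj.ne_iff]; clear * -; decide +revert
    · rw [hC5]; clear * -; decide +revert
  have key : ∀ k, H.Adj y (v k) → H.Adj y (v (k + 2)) → y ∈ Bset H v (k + 1) := by
    intro k hk hk2
    have h1 := hstep _ hk
    have h3 := hstep _ hk2
    have h4 : ¬ H.Adj y (v (k + 4)) := fun h => hstep _ h (by
      rwa [show k + 4 + 1 = k by clear * -; decide +revert])
    rw [show k + 2 + 1 = k + 3 by clear * -; decide +revert] at h3
    refine ⟨hy0, fun l => ?_⟩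
    have hl : l = k ∨ l = k + 1 ∨ l = k + 2 ∨ l = k + 3 ∨ l = k + 4 := by
      clear * -; decide +revert
    rcases hl with rfl | rfl | rfl | rfl | rfl
    · exact iff_of_true hk (by clear * -; decide +revert)
    · exact iff_of_false h1 (by clear * -; decide +revert)
    · exact iff_of_true hk2 (by clear * -; decide +revert)
    · exact iff_of_false h3 (by clear * -; decide +revert)
    · exact iff_of_false h4 (by clear * -; decide +revert)
  rcases hsecond with h | h
  · exact ⟨y, _, hzy, key j hyj h⟩
  · exact ⟨y, _, hzy, key (j + 3) h (by
      rwa [show j + 3 + 2 = j by clear * -; decide +revert])⟩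

theorem stmt12 {V : Type*} [Fintype V] (H : SimpleGraph V) (v : Fin 5 → V)
    (hinj : Function.Injective v)
    (hC5 : ∀ i j : Fin 5, H.Adj (v i) (v j) ↔ (j = i + 1 ∨ i = j + 1))
    (htriangle : H.CliqueFree 3)
    (hP2P3 : ¬ Nonempty (p2p3 ↪g H))
    : (∀ i : Fin 5, ∀ z ∈ S2set H v, (H.neighborSet z ∩ Bset H v i).ncard ≤ 1) ∧
      (∀ i : Fin 5, ∀ y ∈ Bset H v i, (H.neighborSet y ∩ S2set H v).ncard ≤ 1) ∧
      (∑ i : Fin 5, (Bset H v i).ncard ≥ (S2set H v).ncard) := by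
  have hedge : ∀ i : Fin 5, H.Adj (v (i + 2)) (v (i + 3)) := by
    intro i
    rw [hC5]; clear * -; decide +revert
  have hB : ∀ i : Fin 5, ∀ y ∈ Bset H v i, ∀ z ∈ S2set H v, ∀ z' ∈ S2set H v,
      H.Adj y z → H.Adj y z' → z = z' := by
    intro i y hy z hz z' hz' hyz hyz'
    obtain ⟨hy2, hy3⟩ := not_adj_opposite_of_mem_Bset hy
    exact eq_of_adj_of_missing_edge htriangle hP2P3 (hedge i) hyz hyz'
      (hz.2.1 _) (hz.2.1 _) hy2 hy3 (hz'.2.1 _) (hz'.2.1 _)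
  refine ⟨fun i z hz => ?_, fun i y hy => ?_, ?_⟩
  · rw [Set.ncard_le_one]
    rintro y ⟨hzy, hy⟩ y' ⟨hzy', hy'⟩
    obtain ⟨hy2, hy3⟩ := not_adj_opposite_of_mem_Bset hy
    obtain ⟨hy2', hy3'⟩ := not_adj_opposite_of_mem_Bset hy'
    exact eq_of_adj_of_missing_edge htriangle hP2P3 (hedge i) hzy hzy'
      hy2 hy3 (hz.2.1 _) (hz.2.1 _) hy2' hy3'
  · rw [Set.ncard_le_one]
    rintro z ⟨hyz, hz⟩ z' ⟨hyz', hz'⟩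
    exact hB i y hy z hz z' hz' hyz hyz'
  · have hex : ∀ z : V, ∃ y, z ∈ S2set H v → H.Adj z y ∧ ∃ i, y ∈ Bset H v i := by
      intro z
      by_cases hz : z ∈ S2set H v
      · obtain ⟨y, i, hzy, hy⟩ := exists_adj_mem_Bset hinj hC5 htriangle hP2P3 hz
        exact ⟨y, fun _ => ⟨hzy, i, hy⟩⟩
      · exact ⟨z, fun h => absurd h hz⟩
    choose f hf using hex
    calc (S2set H v).ncard ≤ (⋃ i, Bset H v i).ncard := by
          refine Set.ncard_le_ncard_of_injOn f (fun z hz => Set.mem_iUnion.mpr (hf z hz).2) ?_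
          intro z hz z' hz' hzz'
          obtain ⟨hzy, i, hy⟩ := hf z hz
          exact hB i _ hy z hz z' hz' hzy.symm (hzz' ▸ (hf z' hz').1.symm)
      _ ≤ ∑ i : Fin 5, (Bset H v i).ncard := Set.ncard_iUnion_le_of_fintype _
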